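/- arXiv:2305.20043 — 2 statements merged into one kernel-verified Lean document; each statement's English description precedes it below -/
import Mathlib

section
/- (Generalized Rejection Sampling) Under generalized rejection sampling, for every nonzero mask r with π_r > 0, the conditional distribution of the observed part given R = r induced from the true pmf p equals the adversarial observed marginal: P(X_o = x_o | R = r) = p_α^r(x_o) for all observed parts x_o. -/
open Finset

noncomputable section

namespace AM

/-- A mask: `r i = true` means coordinate `i` is observed. -/
abbrev Mask (d : ℕ) := Fin d → Bool

/-- The all-missing mask. -/
def zeroMask (d : ℕ) : Mask d := fun _ => false

variable {d : ℕ} {α : Fin d → Type*} [∀ i, Fintype (α i)] [∀ i, DecidableEq (α i)]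
  [∀ i, Nonempty (α i)]

/-- Restriction of a sample to the observed coordinates of a mask. -/
def restr (r : Mask d) (x : ∀ i, α i) : ∀ i : {i : Fin d // r i = true}, α i.1 :=
  fun i => x i.1

/-- Observed marginal of a pmf under mask `r`. -/
def obsMarg (p : (∀ i, α i) → ℝ) (r : Mask d)
    (xo : ∀ i : {i : Fin d // r i = true}, α i.1) : ℝ :=
  ∑ x : ∀ i, α i, if restr r x = xo then p x else 0

/-- Marginal pmf of the mask under missingness mechanism `q`. -/
def maskMarg (p : (∀ i, α i) → ℝ) (q : Mask d → (∀ i, α i) → ℝ) (r : Mask d) : ℝ :=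
  ∑ x : ∀ i, α i, p x * q r x

/-- Conditional pmf of the observed part given the mask: `P(X_o = x_o | R = r)`. -/
def condObs (p : (∀ i, α i) → ℝ) (q : Mask d → (∀ i, α i) → ℝ) (r : Mask d)
    (xo : ∀ i : {i : Fin d // r i = true}, α i.1) : ℝ :=
  (∑ x : ∀ i, α i, if restr r x = xo then p x * q r x else 0) / maskMarg p q r

/-- The number of missing coordinates of a mask. -/
def missCount {d : ℕ} (r : Mask d) : ℕ := (univ.filter fun i => r i = false).card

/-- Total mass of the nonzero masks. -/
def totMass (p : (∀ i, α i) → ℝ) (q : Mask d → (∀ i, α i) → ℝ) : ℝ :=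
  ∑ r' ∈ univ.filter (fun r' : Mask d => r' ≠ zeroMask d), maskMarg p q r'

/-- The modeler's objective. -/
def Jobj (p : (∀ i, α i) → ℝ) (q : Mask d → (∀ i, α i) → ℝ) (θ : (∀ i, α i) → ℝ) : ℝ :=
  ∑ r : Mask d,
    if r ≠ zeroMask d ∧ 0 < maskMarg p q r then
      maskMarg p q r / totMass p q *
        ∑ xo : ∀ i : {i : Fin d // r i = true}, α i.1,
          condObs p q r xo * Real.log (obsMarg θ r xo)
    else 0

/-- Likelihood ratio of adversarial to true observed marginals. -/
def Lam (p pα : (∀ i, α i) → ℝ) (r : Mask d)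
    (xo : ∀ i : {i : Fin d // r i = true}, α i.1) : ℝ :=
  obsMarg pα r xo / obsMarg p r xo

/-- Maximum of the likelihood ratio over observed parts. -/
def LamMax (p pα : (∀ i, α i) → ℝ) (r : Mask d) : ℝ :=
  Finset.univ.sup' Finset.univ_nonempty (Lam p pα r)

/-- Generalized rejection sampling missingness mechanism with weights `w`. -/
def grs (p pα : (∀ i, α i) → ℝ) (w : Mask d → ℝ) (r : Mask d) (x : ∀ i, α i) : ℝ :=
  if r = zeroMask d then
    1 - ∑ r' ∈ univ.filter (fun r' : Mask d => r' ≠ zeroMask d),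
          w r' * Lam p pα r' (restr r' x) / LamMax p pα r'
  else w r * Lam p pα r (restr r x) / LamMax p pα r

/-- Restriction of a sample to the coordinates in a finset. -/
def restrS (S : Finset (Fin d)) (x : ∀ i, α i) : ∀ i : {i : Fin d // i ∈ S}, α i.1 :=
  fun i => x i.1

/-- Marginal pmf of the coordinates in `S`. -/
def margS (p : (∀ i, α i) → ℝ) (S : Finset (Fin d))
    (xs : ∀ i : {i : Fin d // i ∈ S}, α i.1) : ℝ :=
  ∑ x : ∀ i, α i, if restrS S x = xs then p x else 0

/-- Ratio of adversarial to true marginals on `V`. -/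
def LamV (p pα : (∀ i, α i) → ℝ) (V : Finset (Fin d))
    (xv : ∀ i : {i : Fin d // i ∈ V}, α i.1) : ℝ :=
  margS pα V xv / margS p V xv

/-- Maximum of the ratio over configurations of `V`. -/
def LamVMax (p pα : (∀ i, α i) → ℝ) (V : Finset (Fin d)) : ℝ :=
  Finset.univ.sup' Finset.univ_nonempty (LamV p pα V)

/-- Localized rejection sampling missingness mechanism on `V`. -/
def lrs (p pα : (∀ i, α i) → ℝ) (V : Finset (Fin d)) (r : Mask d) (x : ∀ i, α i) : ℝ :=
  if ∀ i ∉ V, r i = true then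
    if ∃ i ∈ V, r i = true then
      1 / ((2 : ℝ) ^ V.card - 1) * (LamV p pα V (restrS V x) / LamVMax p pα V)
    else 1 - LamV p pα V (restrS V x) / LamVMax p pα V
  else 0

/-- Conditional pmf of the complement coordinates given the `V` coordinates. -/
def condComp (p : (∀ i, α i) → ℝ) (V : Finset (Fin d))
    (xv : ∀ i : {i : Fin d // i ∈ V}, α i.1)
    (xc : ∀ i : {i : Fin d // i ∈ Vᶜ}, α i.1) : ℝ :=
  (∑ x : ∀ i, α i, if restrS V x = xv ∧ restrS Vᶜ x = xc then p x else 0) / margS p V xv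

/-- Conditional pmf of the `V` coordinates given the mask: `P(X_V = x_V | R = r)`. -/
def condV (p : (∀ i, α i) → ℝ) (q : Mask d → (∀ i, α i) → ℝ) (V : Finset (Fin d)) (r : Mask d)
    (xv : ∀ i : {i : Fin d // i ∈ V}, α i.1) : ℝ :=
  (∑ x : ∀ i, α i, if restrS V x = xv then p x * q r x else 0) / maskMarg p q r

/-- Conditional pmf of coordinate `j` given that the coordinates in `S` equal `z`. -/
def condAt (p : (∀ i, α i) → ℝ) (S : Finset (Fin d)) (j : Fin d)
    (z : ∀ i : {i : Fin d // i ∈ S}, α i.1) (a : α j) : ℝ :=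
  (∑ x : ∀ i, α i, if restrS S x = z ∧ x j = a then p x else 0) / margS p S z

/-- `p` factorizes according to the parent structure `pa`. -/
def Factorizes (p : (∀ i, α i) → ℝ) (pa : Fin d → Finset (Fin d)) : Prop :=
  ∀ x, p x = ∏ j, condAt p (pa j) j (restrS (pa j) x) (x j)

/-- KL divergence between two pmfs on a finite type. -/
def KL {β : Type*} [Fintype β] (p q : β → ℝ) : ℝ :=
  ∑ b, p b * Real.log (p b / q b)


/-- The observed part of a sample can be any configuration of the observed coordinates. -/
lemma restr_surjective (r : Mask d) : Function.Surjective (restr (α := α) r) := by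
  intro xo
  refine ⟨fun i => if h : r i = true then xo ⟨i, h⟩ else Classical.arbitrary (α i), ?_⟩
  funext i
  simp [restr, i.2]

/-- Summing over observed parts the sum over the corresponding fibre gives the full sum. -/
lemma sum_sum_restr_eq (f : (∀ i, α i) → ℝ) (r : Mask d) :
    ∑ xo, ∑ x : ∀ i, α i, (if restr r x = xo then f x else 0) = ∑ x, f x := by
  rw [Finset.sum_comm]
  simp

lemma sum_obsMarg (p : (∀ i, α i) → ℝ) (r : Mask d) :
    ∑ xo, obsMarg p r xo = ∑ x, p x :=
  sum_sum_restr_eq p r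

lemma obsMarg_pos {p : (∀ i, α i) → ℝ} (hp : ∀ x, 0 < p x) (r : Mask d)
    (xo : ∀ i : {i : Fin d // r i = true}, α i.1) : 0 < obsMarg p r xo := by
  obtain ⟨x, hx⟩ := restr_surjective r xo
  refine Finset.sum_pos' (fun y _ => ?_) ⟨x, mem_univ x, by simpa [hx] using hp x⟩
  split_ifs
  exacts [(hp y).le, le_rfl]

lemma LamMax_pos {p pα : (∀ i, α i) → ℝ} (hp : ∀ x, 0 < p x) (hpα : 0 < ∑ x, pα x)
    (r : Mask d) : 0 < LamMax p pα r := by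
  rw [← sum_obsMarg pα r] at hpα
  obtain ⟨xo, -, hxo⟩ := Finset.exists_lt_of_sum_lt (by simpa using hpα :
    ∑ _xo : ∀ i : {i : Fin d // r i = true}, α i.1, (0 : ℝ) < ∑ xo, obsMarg pα r xo)
  exact (div_pos hxo (obsMarg_pos hp r xo)).trans_le
    (Finset.le_sup' (Lam p pα r) (mem_univ xo))

/-- Under rejection sampling, the joint mass of an observed part and a nonzero mask is
proportional to the adversarial observed marginal. -/
lemma sum_restr_mul_grs {p : (∀ i, α i) → ℝ} (hp : ∀ x, 0 < p x) (pα : (∀ i, α i) → ℝ)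
    (w : Mask d → ℝ) {r : Mask d} (hr : r ≠ zeroMask d)
    (xo : ∀ i : {i : Fin d // r i = true}, α i.1) :
    (∑ x : ∀ i, α i, if restr r x = xo then p x * grs p pα w r x else 0) =
      w r / LamMax p pα r * obsMarg pα r xo := by
  have hfactor : (∑ x : ∀ i, α i, if restr r x = xo then p x * grs p pα w r x else 0) =
      obsMarg p r xo * (w r * Lam p pα r xo / LamMax p pα r) := by
    rw [obsMarg, Finset.sum_mul]
    refine Finset.sum_congr rfl fun x _ => ?_
    split_ifs with h
    · simp [grs, hr, h]
    · simp
  have hpos := (obsMarg_pos hp r xo).ne'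
  rw [hfactor, Lam]
  field_simp

lemma maskMarg_grs {p : (∀ i, α i) → ℝ} (hp : ∀ x, 0 < p x) (pα : (∀ i, α i) → ℝ)
    (w : Mask d → ℝ) {r : Mask d} (hr : r ≠ zeroMask d) :
    maskMarg p (grs p pα w) r = w r / LamMax p pα r * ∑ x, pα x := by
  rw [maskMarg, ← sum_sum_restr_eq _ r, ← sum_obsMarg pα r, Finset.mul_sum]
  exact Finset.sum_congr rfl fun xo _ => sum_restr_mul_grs hp pα w hr xo

/-- Generalized Rejection Sampling: for every nonzero mask `r` with `π_r > 0`,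
the conditional distribution of the observed part given `R = r` induced from the true pmf `p`
equals the adversarial observed marginal. -/
theorem stmt1
    {d : ℕ} (hd : 1 ≤ d) {α : Fin d → Type*} [∀ i, Fintype (α i)] [∀ i, DecidableEq (α i)]
    [∀ i, Nonempty (α i)]
    (p pα : (∀ i, α i) → ℝ)
    (hp_pos : ∀ x, 0 < p x) (hp_sum : ∑ x, p x = 1)
    (hpα_nonneg : ∀ x, 0 ≤ pα x) (hpα_sum : ∑ x, pα x = 1)
    (w : Mask d → ℝ)
    (hw : ∀ r : Mask d, r ≠ zeroMask d → 0 ≤ w r ∧ w r ≤ 1)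
    (hvalid : ∀ x : ∀ i, α i,
      ∑ r ∈ univ.filter (fun r : Mask d => r ≠ zeroMask d),
          w r * Lam p pα r (restr r x) / LamMax p pα r ≤ 1)
    (r : Mask d) (hr : r ≠ zeroMask d) (hwr : 0 < w r)
    (xo : ∀ i : {i : Fin d // r i = true}, α i.1) :
    condObs p (grs p pα w) r xo = obsMarg pα r xo := by
  have hc : w r / LamMax p pα r ≠ 0 :=
    (div_pos hwr (LamMax_pos hp_pos (hpα_sum ▸ one_pos) r)).ne'
  rw [condObs, sum_restr_mul_grs hp_pos pα w hr, maskMarg_grs hp_pos pα w hr, hpα_sum, mul_one,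
    mul_div_cancel_left₀ _ hc]

end AM
end
end

section
/- Under the localized rejection sampling missingness mechanism on V, the expected missingness rate satisfies the exact identity Σ_r p_R(r)·ℓ_r/d = (1 − 1/Λ)·|V|/d + (1/(Λ·d))·(1/(2^{|V|} − 1))·Σ over masks r that are true on all of V̄ and not identically false on V of ℓ_r. -/
open Finset

noncomputable section

namespace AM

variable {d : ℕ} {α : Fin d → Type*} [∀ i, Fintype (α i)] [∀ i, DecidableEq (α i)]
  [∀ i, Nonempty (α i)]

/-- A positive function has positive marginals. -/
lemma margS_pos (p : (∀ i, α i) → ℝ) (hp_pos : ∀ x, 0 < p x) (S : Finset (Fin d))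
    (xs : ∀ i : {i : Fin d // i ∈ S}, α i.1) : 0 < margS p S xs := by
  classical
  let x₀ : ∀ i, α i := fun i => if h : i ∈ S then xs ⟨i, h⟩ else Classical.arbitrary _
  have hx₀ : restrS S x₀ = xs := by
    funext i
    simp [restrS, x₀, i.2]
  refine Finset.sum_pos' (fun x _ => ?_) ⟨x₀, mem_univ _, ?_⟩
  · split_ifs
    · exact (hp_pos x).le
    · exact le_rfl
  · rw [if_pos hx₀]
    exact hp_pos x₀

/-- The expectation of a function of the `S` coordinates only involves the marginal on `S`. -/
lemma sum_mul_comp_restrS (p : (∀ i, α i) → ℝ) (S : Finset (Fin d))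
    (f : (∀ i : {i : Fin d // i ∈ S}, α i.1) → ℝ) :
    ∑ x, p x * f (restrS S x) = ∑ xs, margS p S xs * f xs := by
  simp only [margS, Finset.sum_mul, ite_mul, zero_mul]
  rw [Finset.sum_comm]
  simp

/-- The likelihood ratio on `V` has expectation one under the true pmf. -/
lemma sum_mul_LamV (p pα : (∀ i, α i) → ℝ) (hp_pos : ∀ x, 0 < p x)
    (hpα_sum : ∑ x, pα x = 1) (V : Finset (Fin d)) :
    ∑ x, p x * LamV p pα V (restrS V x) = 1 := by
  rw [sum_mul_comp_restrS p V (LamV p pα V)]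
  calc ∑ xs, margS p V xs * LamV p pα V xs
      = ∑ xs, margS pα V xs * 1 := Finset.sum_congr rfl fun xs _ => by
        rw [LamV, mul_div_cancel₀ _ (margS_pos p hp_pos V xs).ne', mul_one]
    _ = 1 := by
        rw [← sum_mul_comp_restrS pα V fun _ => 1]
        simpa using hpα_sum

/-- The mask marginal of the localized mechanism. -/
lemma maskMarg_lrs (p pα : (∀ i, α i) → ℝ) (hp_pos : ∀ x, 0 < p x) (hp_sum : ∑ x, p x = 1)
    (hpα_sum : ∑ x, pα x = 1) (V : Finset (Fin d)) (r : Mask d) :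
    maskMarg p (lrs p pα V) r =
      if ∀ i ∉ V, r i = true then
        if ∃ i ∈ V, r i = true then 1 / ((2 : ℝ) ^ V.card - 1) * (1 / LamVMax p pα V)
        else 1 - 1 / LamVMax p pα V
      else 0 := by
  have hratio : ∑ x, p x * (LamV p pα V (restrS V x) / LamVMax p pα V)
      = 1 / LamVMax p pα V := by
    simp only [← mul_div_assoc]
    rw [← Finset.sum_div, sum_mul_LamV p pα hp_pos hpα_sum V]
  unfold maskMarg lrs
  split_ifs
  · simp only [mul_left_comm (p _)]
    rw [← Finset.mul_sum, hratio]
  · simp only [mul_sub, mul_one]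
    rw [Finset.sum_sub_distrib, hp_sum, hratio]
  · simp

/-- The only mask observing exactly the complement of `V`. -/
lemma filter_mask_eq_singleton (V : Finset (Fin d)) :
    univ.filter (fun r : Mask d => (∀ i ∉ V, r i = true) ∧ ¬ ∃ i ∈ V, r i = true)
      = {fun i => decide (i ∉ V)} := by
  ext r
  simp only [mem_filter, mem_univ, true_and, mem_singleton]
  constructor
  · rintro ⟨h₁, h₂⟩
    funext i
    by_cases hi : i ∈ V
    · simpa [hi] using fun h => h₂ ⟨i, hi, h⟩
    · simp [hi, h₁ i hi]
  · rintro rfl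
    simp

/-- The mask missing exactly `V` has `|V|` missing coordinates. -/
lemma missCount_decide_notMem (V : Finset (Fin d)) :
    missCount (fun i => decide (i ∉ V)) = V.card := by
  simp [missCount]

/-- under localized rejection sampling on `V`, the expected missingness rate
satisfies the exact identity
`Σ_r p_R(r)·ℓ_r/d = (1 − 1/Λ)·|V|/d + (1/(Λd))·(1/(2^{|V|} − 1))·Σ_{r ∈ A} ℓ_r`,
where `A` is the set of masks observing all of `V̄` and part of `V`. -/
theorem stmt9
    {d : ℕ} (hd : 1 ≤ d) {α : Fin d → Type*} [∀ i, Fintype (α i)] [∀ i, DecidableEq (α i)]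
    [∀ i, Nonempty (α i)]
    (p pα : (∀ i, α i) → ℝ)
    (hp_pos : ∀ x, 0 < p x) (hp_sum : ∑ x, p x = 1)
    (hpα_nonneg : ∀ x, 0 ≤ pα x) (hpα_sum : ∑ x, pα x = 1)
    (V : Finset (Fin d)) (hV : V.Nonempty) :
    ∑ r : Mask d, maskMarg p (lrs p pα V) r * ((missCount r : ℝ) / d)
      = (1 - 1 / LamVMax p pα V) * ((V.card : ℝ) / d)
        + 1 / (LamVMax p pα V * d) * (1 / ((2 : ℝ) ^ V.card - 1)) *
          ∑ r ∈ univ.filter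
              (fun r : Mask d => (∀ i ∉ V, r i = true) ∧ ∃ i ∈ V, r i = true),
            (missCount r : ℝ) := by
  have hterm : ∀ r : Mask d, maskMarg p (lrs p pα V) r * ((missCount r : ℝ) / d)
      = (if (∀ i ∉ V, r i = true) ∧ ¬ ∃ i ∈ V, r i = true then
          (1 - 1 / LamVMax p pα V) * ((missCount r : ℝ) / d) else 0)
        + if (∀ i ∉ V, r i = true) ∧ ∃ i ∈ V, r i = true then
          1 / (LamVMax p pα V * d) * (1 / ((2 : ℝ) ^ V.card - 1)) * (missCount r : ℝ)
          else 0 := by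
    intro r
    rw [maskMarg_lrs p pα hp_pos hp_sum hpα_sum V r]
    by_cases h₁ : ∀ i ∉ V, r i = true
    · by_cases h₂ : ∃ i ∈ V, r i = true
      · rw [if_pos h₁, if_pos h₂, if_neg fun h => h.2 h₂, if_pos ⟨h₁, h₂⟩, one_div_mul_eq_div]
        simp only [div_eq_mul_inv, mul_inv]
        ring
      · rw [if_pos h₁, if_neg h₂, if_pos ⟨h₁, h₂⟩, if_neg fun h => h₂ h.2, add_zero]
    · rw [if_neg h₁, if_neg fun h => h₁ h.1, if_neg fun h => h₁ h.1, zero_mul, add_zero]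
  rw [Finset.sum_congr rfl fun r _ => hterm r, Finset.sum_add_distrib, ← Finset.sum_filter,
    ← Finset.sum_filter, filter_mask_eq_singleton, Finset.sum_singleton,
    missCount_decide_notMem, Finset.mul_sum]

end AM
end
end
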